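/- arXiv:1305.6353 — 5 statements merged into one kernel-verified Lean document; each statement's English description precedes it below -/
import Mathlib

section
/- Let L be an even lattice that admits an orthogonal direct sum decomposition L ≅ U ⊕ U ⊕ M for some lattice M. Let v, v′ ∈ L be primitive elements with B(v,v) = B(v′,v′) and div_L(v) = div_L(v′) = d, and suppose v/d and v′/d define the same class in the discriminant group of L, i.e. there exists w ∈ L with B(v,x) − B(v′,x) = d·B(w,x) for all x ∈ L. Then there exists an isometry φ ∈ O(L) with φ(v) = v′ (Eichler's criterion). -/
open Matrix

/-- The Gram pairing `(x, y) ↦ xᵀ G y` of an integer matrix `G`, as a bilinear map. -/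
def gramBilin {n : ℕ} (G : Matrix (Fin n) (Fin n) ℤ) :
    (Fin n → ℤ) →ₗ[ℤ] (Fin n → ℤ) →ₗ[ℤ] ℤ :=
  Matrix.toLinearMap₂' ℤ G

/-- The hyperbolic plane `U`, with Gram matrix `[[0,1],[1,0]]`. -/
def UGram : Matrix (Fin 2) (Fin 2) ℤ := !![0, 1; 1, 0]

/-- Orthogonal direct sum of two bilinear forms, on the product module. -/
def prodBilin {M N : Type*} [AddCommGroup M] [AddCommGroup N] [Module ℤ M] [Module ℤ N]
    (BM : M →ₗ[ℤ] M →ₗ[ℤ] ℤ) (BN : N →ₗ[ℤ] N →ₗ[ℤ] ℤ) :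
    (M × N) →ₗ[ℤ] (M × N) →ₗ[ℤ] ℤ :=
  LinearMap.mk₂ ℤ (fun x y => BM x.1 y.1 + BN x.2 y.2)
    (by intro m₁ m₂ n; simp [map_add]; ring)
    (by intro c m n; simp [_root_.map_smul, smul_eq_mul]; ring)
    (by intro m n₁ n₂; simp [map_add]; ring)
    (by intro c m n; simp [_root_.map_smul, smul_eq_mul]; ring)

/-- `x` and `y` lie in the same orbit of the isometry group of `B`. -/
def SameOrbit {L : Type*} [AddCommGroup L] (B : L →+ L →+ ℤ) (x y : L) :
    Prop :=
  ∃ φ : L ≃+ L, (∀ x y, B (φ x) (φ y) = B x y) ∧ φ x = y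

namespace SameOrbit

variable {L : Type*} [AddCommGroup L] {B : L →+ L →+ ℤ} {x y z : L}

theorem refl (x : L) : SameOrbit B x x :=
  ⟨AddEquiv.refl L, fun _ _ => rfl, rfl⟩

theorem symm (h : SameOrbit B x y) : SameOrbit B y x := by
  obtain ⟨φ, hφ, rfl⟩ := h
  refine ⟨φ.symm, fun a b => ?_, by simp⟩
  rw [← hφ, φ.apply_symm_apply, φ.apply_symm_apply]

theorem trans (h : SameOrbit B x y) (h' : SameOrbit B y z) : SameOrbit B x z := by
  obtain ⟨φ, hφ, rfl⟩ := h
  obtain ⟨ψ, hψ, rfl⟩ := h'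
  exact ⟨φ.trans ψ, fun a b => by simp [hψ, hφ], by simp⟩

theorem apply_self_eq (h : SameOrbit B x y) : B x x = B y y := by
  obtain ⟨φ, hφ, rfl⟩ := h
  exact (hφ x x).symm

theorem dvd_apply (h : SameOrbit B x y) {d : ℤ} (hd : ∀ t, d ∣ B x t) (t : L) : d ∣ B y t := by
  obtain ⟨φ, hφ, rfl⟩ := h
  rw [← φ.apply_symm_apply t, hφ]
  exact hd _

theorem exists_apply_eq (h : SameOrbit B x y) {d : ℤ} (hd : ∃ t, B x t = d) :
    ∃ t, B y t = d := by
  obtain ⟨φ, hφ, rfl⟩ := h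
  obtain ⟨t, ht⟩ := hd
  exact ⟨φ t, by rw [hφ, ht]⟩

end SameOrbit

/-- The Eichler transvection attached to `e` and `a`, as an additive map; `q` plays the role of
half the norm of `a`. -/
def eichlerMap {L : Type*} [AddCommGroup L] (B : L →+ L →+ ℤ) (e a : L) (q : ℤ) : L →+ L :=
  AddMonoidHom.mk' (fun x => x - B a x • e + B e x • a - (q * B e x) • e) fun x y => by
    simp only [map_add]
    module

theorem eichlerMap_apply {L : Type*} [AddCommGroup L] (B : L →+ L →+ ℤ)
    (e a : L) (q : ℤ) (x : L) :
    eichlerMap B e a q x = x - B a x • e + B e x • a - (q * B e x) • e :=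
  rfl

theorem eichlerMap_eichlerMap_neg {L : Type*} [AddCommGroup L]
    {B : L →+ L →+ ℤ} (hsymm : ∀ x y, B x y = B y x) {e a : L} {q : ℤ}
    (he : B e e = 0) (hea : B e a = 0) (ha : B a a = 2 * q) (x : L) :
    eichlerMap B e a q (eichlerMap B e (-a) q x) = x := by
  have hae : B a e = 0 := by rw [hsymm, hea]
  simp only [eichlerMap_apply, map_sub, map_add, map_neg, map_zsmul, AddMonoidHom.neg_apply,
    he, hea, hae, ha]
  module

theorem SameOrbit.eichler {L : Type*} [AddCommGroup L]
    {B : L →+ L →+ ℤ} (hsymm : ∀ x y, B x y = B y x) {e a : L} {q : ℤ}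
    (he : B e e = 0) (hea : B e a = 0) (ha : B a a = 2 * q) (x : L) :
    SameOrbit B x (x - B a x • e + B e x • a - (q * B e x) • e) := by
  have hinv := eichlerMap_eichlerMap_neg hsymm he hea ha
  have hinv' := eichlerMap_eichlerMap_neg hsymm (a := -a) (q := q) he (by simp [hea])
    (by simp [ha])
  rw [neg_neg] at hinv'
  refine ⟨(eichlerMap B e a q).toAddEquiv (eichlerMap B e (-a) q)
    (AddMonoidHom.ext hinv') (AddMonoidHom.ext hinv), fun x y => ?_, eichlerMap_apply B e a q x⟩
  have hae : B a e = 0 := by rw [hsymm, hea]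
  have hsmul : ∀ (n : ℤ) (f : L →+ ℤ) (t : L), (n • f) t = n * f t := fun n f t => by simp
  simp only [AddMonoidHom.toAddEquiv_apply, eichlerMap_apply, map_sub, map_add, map_zsmul,
    AddMonoidHom.sub_apply, AddMonoidHom.add_apply, hsmul,
    smul_eq_mul, he, hea, hae, ha, hsymm x e, hsymm x a]
  ring

/-- The form on `U ⊕ U ⊕ M`. -/
def doubleHyperbolicForm {M : Type*} [AddCommGroup M] (BM : M →+ M →+ ℤ) :
    ((Fin 2 → ℤ) × (Fin 2 → ℤ) × M) →+ ((Fin 2 → ℤ) × (Fin 2 → ℤ) × M) →+ ℤ :=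
  AddMonoidHom.mk' (fun x => AddMonoidHom.mk' (fun y => x.1 0 * y.1 1 + x.1 1 * y.1 0 +
      (x.2.1 0 * y.2.1 1 + x.2.1 1 * y.2.1 0 + BM x.2.2 y.2.2))
    fun y z => by simp; ring) fun x y => by
    ext z
    simp
    ring

theorem doubleHyperbolicForm_apply {M : Type*} [AddCommGroup M] (BM : M →+ M →+ ℤ)
    (x y : (Fin 2 → ℤ) × (Fin 2 → ℤ) × M) :
    doubleHyperbolicForm BM x y = x.1 0 * y.1 1 + x.1 1 * y.1 0 +
      (x.2.1 0 * y.2.1 1 + x.2.1 1 * y.2.1 0 + BM x.2.2 y.2.2) :=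
  rfl

theorem prodBilin_gramBilin_UGram_apply {M : Type*} [AddCommGroup M] [Module ℤ M]
    (BM : M →ₗ[ℤ] M →ₗ[ℤ] ℤ) (x y : (Fin 2 → ℤ) × (Fin 2 → ℤ) × M) :
    prodBilin (gramBilin UGram) (prodBilin (gramBilin UGram) BM) x y =
      x.1 0 * y.1 1 + x.1 1 * y.1 0 +
        (x.2.1 0 * y.2.1 1 + x.2.1 1 * y.2.1 0 + BM x.2.2 y.2.2) := by
  simp [prodBilin, gramBilin, UGram, Matrix.toLinearMap₂'_apply, Fin.sum_univ_two]

section DoubleHyperbolic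

variable {M : Type*} [AddCommGroup M] {BM : M →+ M →+ ℤ}

theorem doubleHyperbolicForm_symm (hsymm : ∀ x y, BM x y = BM y x)
    (x y : (Fin 2 → ℤ) × (Fin 2 → ℤ) × M) :
    doubleHyperbolicForm BM x y = doubleHyperbolicForm BM y x := by
  rw [doubleHyperbolicForm_apply, doubleHyperbolicForm_apply, hsymm]
  ring

theorem sameOrbit_swap_fst (a b c d : ℤ) (m : M) :
    SameOrbit (doubleHyperbolicForm BM) (![a, b], ![c, d], m) (![b, a], ![c, d], m) := by
  refine ⟨(LinearEquiv.funCongrLeft ℤ ℤ (Equiv.swap 0 1)).toAddEquiv.prodCongr (AddEquiv.refl _),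
    fun x y => ?_, ?_⟩
  · change x.1 1 * y.1 0 + x.1 0 * y.1 1 + _ = _
    rw [add_comm (x.1 1 * y.1 0)]
    rfl
  · refine Prod.ext (funext fun i => ?_) rfl
    fin_cases i <;> rfl

theorem sameOrbit_neg_fst (a b c d : ℤ) (m : M) :
    SameOrbit (doubleHyperbolicForm BM) (![a, b], ![c, d], m) (![-a, -b], ![c, d], m) := by
  refine ⟨(AddEquiv.neg _).prodCongr (AddEquiv.refl _), fun x y => ?_, ?_⟩
  · change -x.1 0 * -y.1 1 + -x.1 1 * -y.1 0 + _ = _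
    rw [neg_mul_neg, neg_mul_neg]
    rfl
  · refine Prod.ext (funext fun i => ?_) rfl
    fin_cases i <;> rfl

theorem sameOrbit_swap_planes (a b c d : ℤ) (m : M) :
    SameOrbit (doubleHyperbolicForm BM) (![a, b], ![c, d], m) (![c, d], ![a, b], m) := by
  refine ⟨AddEquiv.prodAssoc.symm.trans
    ((AddEquiv.prodComm.prodCongr (AddEquiv.refl _)).trans AddEquiv.prodAssoc), fun x y => ?_, ?_⟩
  · exact add_left_comm _ _ _
  · rfl

theorem sameOrbit_swap_snd (a b c d : ℤ) (m : M) :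
    SameOrbit (doubleHyperbolicForm BM) (![a, b], ![c, d], m) (![a, b], ![d, c], m) :=
  ((sameOrbit_swap_planes a b c d m).trans (sameOrbit_swap_fst c d a b m)).trans
    (sameOrbit_swap_planes d c a b m)

theorem sameOrbit_add_mul (hsymm : ∀ x y, BM x y = BM y x) (k a b c d : ℤ) (m : M) :
    SameOrbit (doubleHyperbolicForm BM) (![a, b], ![c, d], m)
      (![a, b - k * d], ![c + k * a, d], m) := by
  convert SameOrbit.eichler (doubleHyperbolicForm_symm hsymm) (e := (![0, 1], ![0, 0], 0))
    (a := (![0, 0], ![k, 0], 0)) (q := 0) ?_ ?_ ?_ (![a, b], ![c, d], m) using 1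
  · simp [doubleHyperbolicForm_apply, mul_comm]
  all_goals simp [doubleHyperbolicForm_apply]

theorem exists_sameOrbit_dvd_of_ne_zero (hsymm : ∀ x y, BM x y = BM y x) (m : M)
    (a b c d : ℤ) (ha : a ≠ 0) :
    ∃ g y, SameOrbit (doubleHyperbolicForm BM) (![a, b], ![c, d], m) (![g, y], ![0, 0], m) ∧
      g ∣ a ∧ g ∣ b ∧ g ∣ c ∧ g ∣ d := by
  induction hn : a.natAbs using Nat.strong_induction_on generalizing a b c d with
  | _ n ih =>
  subst hn
  have key : ∀ b c d : ℤ, ¬ a ∣ c → ∃ g y, SameOrbit (doubleHyperbolicForm BM)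
      (![a, b], ![c, d], m) (![g, y], ![0, 0], m) ∧ g ∣ a ∧ g ∣ b ∧ g ∣ c ∧ g ∣ d := by
    intro b c d hc
    have hmod : c + -(c / a) * a = c % a := by rw [Int.emod_def]; ring
    have hne : c % a ≠ 0 := fun h => hc (Int.dvd_of_emod_eq_zero h)
    have hlt : (c % a).natAbs < a.natAbs := by
      have h1 := Int.emod_nonneg c ha
      have h2 := Int.emod_lt_abs c ha
      rw [← Int.ofNat_lt, Int.natCast_natAbs, Int.natCast_natAbs, abs_of_nonneg h1]
      exact h2
    obtain ⟨g, y, h, h1, h2, h3, h4⟩ := ih _ hlt (c % a) d a (b - -(c / a) * d) hne rfl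
    refine ⟨g, y, ?_, h3, ?_, ?_, h2⟩
    · have h0 := sameOrbit_add_mul hsymm (-(c / a)) a b c d m
      rw [hmod] at h0
      exact (h0.trans (sameOrbit_swap_planes _ _ _ _ _)).trans h
    · exact (dvd_sub_left (h2.mul_left _)).1 h4
    · rw [← hmod] at h1
      exact (dvd_add_left (h3.mul_left _)).1 h1
  by_cases hc : a ∣ c
  swap
  · exact key b c d hc
  by_cases hd : a ∣ d
  swap
  · obtain ⟨g, y, h, h1, h2, h3, h4⟩ := key b d c hd
    exact ⟨g, y, (sameOrbit_swap_snd _ _ _ _ _).trans h, h1, h2, h4, h3⟩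
  obtain ⟨r, rfl⟩ := hc
  obtain ⟨s, rfl⟩ := hd
  have hclear : SameOrbit (doubleHyperbolicForm BM) (![a, b], ![a * r, a * s], m)
      (![a, b + r * (a * s)], ![0, 0], m) := by
    have h1 := sameOrbit_add_mul hsymm (-r) a b (a * r) (a * s) m
    have h2 := sameOrbit_add_mul hsymm (-s) a (b - -r * (a * s)) (a * s) 0 m
    rw [show a * r + -r * a = 0 by ring] at h1
    rw [show a * s + -s * a = 0 by ring,
      show b - -r * (a * s) - -s * 0 = b + r * (a * s) by ring] at h2
    exact (h1.trans (sameOrbit_swap_snd _ _ _ _ _)).trans h2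
  by_cases hb : a ∣ b
  · exact ⟨a, _, hclear, dvd_rfl, hb, dvd_mul_right _ _, dvd_mul_right _ _⟩
  · set y := b + r * (a * s) with hy
    have hay : ¬ a ∣ y := fun h =>
      hb ((dvd_add_left ((dvd_mul_right a s).mul_left r)).1 h)
    have hmix : SameOrbit (doubleHyperbolicForm BM) (![a, y], ![0, 0], m)
        (![a, y], ![y, 0], m) := by
      have h := sameOrbit_add_mul hsymm 1 y a 0 0 m
      rw [show a - 1 * 0 = a by ring, show 0 + 1 * y = y by ring] at h
      exact ((sameOrbit_swap_fst _ _ _ _ _).trans h).trans (sameOrbit_swap_fst _ _ _ _ _)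
    obtain ⟨g, z, h, h1, h2, -, -⟩ := key y y 0 hay
    exact ⟨g, z, (hclear.trans hmix).trans h, h1,
      (dvd_add_left ((h1.mul_right s).mul_left r)).1 h2, h1.mul_right _, h1.mul_right _⟩

theorem exists_sameOrbit_dvd (hsymm : ∀ x y, BM x y = BM y x) (m : M) (a b c d : ℤ) :
    ∃ g y, SameOrbit (doubleHyperbolicForm BM) (![a, b], ![c, d], m) (![g, y], ![0, 0], m) ∧
      g ∣ a ∧ g ∣ b ∧ g ∣ c ∧ g ∣ d := by
  by_cases ha : a = 0
  swap
  · exact exists_sameOrbit_dvd_of_ne_zero hsymm m a b c d ha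
  by_cases hb : b = 0
  swap
  · obtain ⟨g, y, h, h1, h2, h3, h4⟩ := exists_sameOrbit_dvd_of_ne_zero hsymm m b a c d hb
    exact ⟨g, y, (sameOrbit_swap_fst _ _ _ _ _).trans h, h2, h1, h3, h4⟩
  by_cases hc : c = 0
  swap
  · obtain ⟨g, y, h, h1, h2, h3, h4⟩ := exists_sameOrbit_dvd_of_ne_zero hsymm m c d a b hc
    exact ⟨g, y, (sameOrbit_swap_planes _ _ _ _ _).trans h, h3, h4, h1, h2⟩
  by_cases hd : d = 0
  swap
  · obtain ⟨g, y, h, h1, h2, h3, h4⟩ := exists_sameOrbit_dvd_of_ne_zero hsymm m d c a b hd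
    exact ⟨g, y, ((sameOrbit_swap_snd _ _ _ _ _).trans (sameOrbit_swap_planes _ _ _ _ _)).trans h,
      h3, h4, h2, h1⟩
  subst ha hb hc hd
  exact ⟨0, 0, SameOrbit.refl _, by simp⟩

/-- A vector of divisibility `d` can be moved by an isometry, without changing its component
in `M`, to one whose component in `U ⊕ U` lies in the first plane and has first coordinate `d`. -/
theorem exists_sameOrbit_normal_form (hsymm : ∀ x y, BM x y = BM y x)
    (heven : ∀ m, (2 : ℤ) ∣ BM m m) {d : ℤ} (x : (Fin 2 → ℤ) × (Fin 2 → ℤ) × M)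
    (hdvd : ∀ t, d ∣ doubleHyperbolicForm BM x t)
    (hex : ∃ t, doubleHyperbolicForm BM x t = d) :
    ∃ y, SameOrbit (doubleHyperbolicForm BM) x (![d, y], ![0, 0], x.2.2) := by
  obtain ⟨p, q, m⟩ := x
  have hx : ((p, q, m) : (Fin 2 → ℤ) × (Fin 2 → ℤ) × M) = (![p 0, p 1], ![q 0, q 1], m) := by
    refine Prod.ext (funext fun i => ?_) (Prod.ext (funext fun i => ?_) rfl) <;>
      fin_cases i <;> rfl
  obtain ⟨a, b, hab, -⟩ := exists_sameOrbit_dvd hsymm m (p 0) (p 1) (q 0) (q 1)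
  rw [← hx] at hab
  obtain ⟨t, ht⟩ := hab.exists_apply_eq hex
  obtain ⟨k, hk⟩ := heven t.2.2
  have htrans : SameOrbit (doubleHyperbolicForm BM) (![a, b], ![0, 0], m)
      (![a, b], ![-BM t.2.2 m, 0], m) := by
    convert SameOrbit.eichler (doubleHyperbolicForm_symm hsymm) (e := (![0, 0], ![1, 0], 0))
      (a := (![0, 0], ![0, 0], t.2.2)) (q := k) ?_ ?_ ?_ (![a, b], ![0, 0], m) using 1
    · simp [doubleHyperbolicForm_apply]
    all_goals simp [doubleHyperbolicForm_apply, hk]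
  obtain ⟨g, y, hg, hga, hgb, hgc, -⟩ := exists_sameOrbit_dvd hsymm m a b (-BM t.2.2 m) 0
  have hfin := (hab.trans htrans).trans hg
  have hgd : g ∣ d := by
    rw [← ht, doubleHyperbolicForm_apply, hsymm]
    simpa using dvd_add (dvd_add (hga.mul_right _) (hgb.mul_right _)) (dvd_neg.1 hgc)
  have hdg : d ∣ g := by
    simpa [doubleHyperbolicForm_apply] using hfin.dvd_apply hdvd (![0, 1], ![0, 0], 0)
  rcases Int.natAbs_eq_natAbs_iff.1 (Int.natAbs_eq_of_dvd_dvd hdg hgd) with rfl | rfl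
  · exact ⟨y, hfin⟩
  · exact ⟨-y, by simpa using hfin.trans (sameOrbit_neg_fst _ _ _ _ _)⟩

theorem sameOrbit_of_normal_form (hsymm : ∀ x y, BM x y = BM y x)
    (heven : ∀ m, (2 : ℤ) ∣ BM m m) {d : ℤ} (hd : d ≠ 0) (y y' : ℤ) (m u : M)
    (hnorm : doubleHyperbolicForm BM (![d, y], ![0, 0], m) (![d, y], ![0, 0], m) =
      doubleHyperbolicForm BM (![d, y'], ![0, 0], m + d • u) (![d, y'], ![0, 0], m + d • u)) :
    SameOrbit (doubleHyperbolicForm BM) (![d, y], ![0, 0], m)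
      (![d, y'], ![0, 0], m + d • u) := by
  obtain ⟨k, hk⟩ := heven u
  have hy : y' = y - BM u m - k * d := by
    simp [doubleHyperbolicForm_apply, hk, hsymm m u] at hnorm
    have : 2 * d * y' = 2 * d * (y - BM u m - k * d) := by linear_combination -hnorm
    exact mul_left_cancel₀ (mul_ne_zero two_ne_zero hd) this
  convert SameOrbit.eichler (doubleHyperbolicForm_symm hsymm) (e := (![0, 1], ![0, 0], 0))
    (a := (![0, 0], ![0, 0], u)) (q := k) ?_ ?_ ?_ (![d, y], ![0, 0], m) using 1
  · simp [doubleHyperbolicForm_apply, hy]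
  all_goals simp [doubleHyperbolicForm_apply, hk]

theorem eq_add_zsmul_of_form_sub_eq (hnondeg : ∀ x, (∀ y, BM x y = 0) → x = 0) {d : ℤ}
    {m m' w : M} (h : ∀ t, BM m t - BM m' t = d * BM w t) : m' = m + d • (-w) := by
  rw [← sub_eq_zero]
  refine hnondeg _ fun t => ?_
  have := h t
  simp
  linarith

end DoubleHyperbolic

/-- **Eichler's criterion.**
Let `L` be an even lattice (finitely generated free ℤ-module with a nondegenerate symmetric
even bilinear form `B`) admitting an orthogonal direct sum decomposition `L ≅ U ⊕ U ⊕ M`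
for some lattice `M` (witnessed by the isometry `e`).  If `v, v'` are primitive elements of
`L` with `B(v,v) = B(v',v')`, with the same divisibility `d > 0`, and defining the same
class in the discriminant group (i.e. `B(v,x) − B(v',x) = d·B(w,x)` for all `x`, for some
`w ∈ L`), then some isometry `φ ∈ O(L)` sends `v` to `v'`. -/
theorem eichler_criterion
    {L : Type*} [AddCommGroup L] [Module ℤ L] [Module.Free ℤ L] [Module.Finite ℤ L]
    (B : L →ₗ[ℤ] L →ₗ[ℤ] ℤ)
    (hsymm : ∀ x y, B x y = B y x)
    (hnondeg : ∀ x : L, (∀ y, B x y = 0) → x = 0)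
    (heven : ∀ x, (2 : ℤ) ∣ B x x)
    -- the lattice M
    {M : Type*} [AddCommGroup M] [Module ℤ M] [Module.Free ℤ M] [Module.Finite ℤ M]
    (BM : M →ₗ[ℤ] M →ₗ[ℤ] ℤ)
    (hMsymm : ∀ x y, BM x y = BM y x)
    (hMnondeg : ∀ x : M, (∀ y, BM x y = 0) → x = 0)
    -- the orthogonal decomposition L ≅ U ⊕ U ⊕ M
    (e : L ≃ₗ[ℤ] ((Fin 2 → ℤ) × (Fin 2 → ℤ) × M))
    (he : ∀ x y : L,
      B x y = prodBilin (gramBilin UGram) (prodBilin (gramBilin UGram) BM) (e x) (e y))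
    -- the elements v, v'
    (v v' : L)
    (hvprim : ∀ (x : L) (n : ℤ), n ≠ 0 → n • x ∈ Submodule.span ℤ {v} →
      x ∈ Submodule.span ℤ {v})
    (hv'prim : ∀ (x : L) (n : ℤ), n ≠ 0 → n • x ∈ Submodule.span ℤ {v'} →
      x ∈ Submodule.span ℤ {v'})
    (hsq : B v v = B v' v')
    (d : ℤ) (hd : 0 < d)
    (hdivv : (∀ x, d ∣ B v x) ∧ ∃ x, B v x = d)
    (hdivv' : (∀ x, d ∣ B v' x) ∧ ∃ x, B v' x = d)
    (hclass : ∃ w : L, ∀ x, B v x - B v' x = d * B w x) :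
    ∃ φ : L ≃ₗ[ℤ] L, (∀ x y, B (φ x) (φ y) = B x y) ∧ φ v = v' := by
  let bm : M →+ M →+ ℤ := AddMonoidHom.mk' (fun x => (BM x).toAddMonoidHom) fun x y => by
    ext z
    simp
  have hform : ∀ x y, B x y = doubleHyperbolicForm bm (e x) (e y) := fun x y =>
    (he x y).trans (prodBilin_gramBilin_UGram_apply BM _ _)
  have hMeven : ∀ m, (2 : ℤ) ∣ bm m m := by
    intro m
    have h := heven (e.symm (0, 0, m))
    rw [hform, e.apply_symm_apply] at h
    simpa [doubleHyperbolicForm_apply] using h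
  have hnf : ∀ z : L, ((∀ x, d ∣ B z x) ∧ ∃ x, B z x = d) → ∃ y,
      SameOrbit (doubleHyperbolicForm bm) (e z) (![d, y], ![0, 0], (e z).2.2) := by
    rintro z ⟨hdvd, x, hx⟩
    refine exists_sameOrbit_normal_form hMsymm hMeven (e z) (fun t => ?_) ⟨e x, ?_⟩
    · rw [← e.apply_symm_apply t, ← hform]
      exact hdvd _
    · rw [← hform, hx]
  obtain ⟨y, hy⟩ := hnf v hdivv
  obtain ⟨y', hy'⟩ := hnf v' hdivv'
  obtain ⟨w, hw⟩ := hclass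
  have hm := eq_add_zsmul_of_form_sub_eq (BM := bm) hMnondeg (d := d) (m := (e v).2.2)
    (m' := (e v').2.2) (w := (e w).2.2) fun t => by
      have h := hw (e.symm (0, 0, t))
      rw [hform, hform, hform, e.apply_symm_apply] at h
      simpa [doubleHyperbolicForm_apply] using h
  rw [hm] at hy'
  have hmid := sameOrbit_of_normal_form hMsymm hMeven hd.ne' y y' (e v).2.2 (-(e w).2.2)
    (by rw [← hy.apply_self_eq, ← hy'.apply_self_eq, ← hform, ← hform, hsq])
  obtain ⟨φ, hφ, hφv⟩ := (hy.trans hmid).trans hy'.symm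
  let ψ : L ≃+ L := e.toAddEquiv.trans (φ.trans e.toAddEquiv.symm)
  have hψ : ∀ a, e (ψ a) = φ (e a) := fun a => e.apply_symm_apply _
  refine ⟨{ ψ with map_smul' := fun n x => ?_ }, fun a b => ?_, ?_⟩
  · exact (congrArg ψ (int_smul_eq_zsmul _ n x)).trans
      ((map_zsmul ψ n x).trans (int_smul_eq_zsmul _ n (ψ x)).symm)
  · change B (ψ a) (ψ b) = B a b
    rw [hform, hψ, hψ, hφ, ← hform]
  · exact e.injective ((hψ v).trans hφv)
end

section
/- Let L be an even unimodular lattice, i.e. an even lattice for which the map L → Hom(L,ℤ), x ↦ B(x,−), is bijective, and let ι ∈ O(L) be an involution (ι² = id). Then the invariant sublattice L^ι is 2-elementary: for every x in the ℚ-span of L^ι inside L ⊗ ℚ with B(x,y) ∈ ℤ for all y ∈ L^ι, one has 2x ∈ L^ι. -/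
/-- **The invariant sublattice of an involution on an even unimodular lattice is
2-elementary.**
Let `L` be an even unimodular lattice: a finitely generated free ℤ-module with a symmetric
even bilinear form `B` such that `x ↦ B(x,−)` is a bijection `L → Hom(L,ℤ)`.  Let `ι ∈ O(L)`
be an involution.  Then the invariant sublattice `L^ι` is 2-elementary: every element of the
ℚ-span of `L^ι` in `L ⊗ ℚ` pairing integrally with `L^ι` is halved into `L^ι` after doubling.
Here such an element of `L ⊗ ℚ` is written as `(1/n) • k` with `k ∈ L^ι` and `n ≠ 0`; the
integrality of its pairings with `L^ι` reads `n ∣ B(k,y)` for all `y ∈ L^ι`, and the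
conclusion `2 • ((1/n) • k) ∈ L^ι` reads `∃ k' ∈ L^ι, n • k' = 2 • k`. -/
theorem invariant_sublattice_two_elementary
    {L : Type*} [AddCommGroup L] [Module ℤ L] [Module.Free ℤ L] [Module.Finite ℤ L]
    (B : L →ₗ[ℤ] L →ₗ[ℤ] ℤ)
    (hsymm : ∀ x y, B x y = B y x)
    (heven : ∀ x, (2 : ℤ) ∣ B x x)
    (hunimod : Function.Bijective fun x : L => B x)
    (ι : L ≃ₗ[ℤ] L)
    (hisom : ∀ x y, B (ι x) (ι y) = B x y)
    (hinvol : ∀ x, ι (ι x) = x) :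
    ∀ k : L, ι k = k → ∀ n : ℤ, n ≠ 0 →
      (∀ y : L, ι y = y → n ∣ B k y) →
      ∃ k' : L, ι k' = k' ∧ n • k' = (2 : ℤ) • k := by
  intro k hk n hn hdvd
  have key : ∀ x, n ∣ 2 * B k x := fun x => by
    have h := hdvd (x + ι x) (by rw [map_add, hinvol, add_comm])
    have hιx : B k (ι x) = B k x := by
      rw [← hisom k x, hk]
    rwa [map_add, hιx, ← two_mul] at h
  choose f hf using key
  let φ : L →ₗ[ℤ] ℤ :=
    { toFun := f
      map_add' := fun x y => mul_left_cancel₀ hn (by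
        rw [← hf, map_add, mul_add, mul_add, hf, hf])
      map_smul' := fun c x => mul_left_cancel₀ hn (by
        rw [← hf, LinearMap.map_smul, smul_eq_mul, RingHom.id_apply, smul_eq_mul, mul_left_comm, hf,
          mul_left_comm]) }
  obtain ⟨k', hk'⟩ := hunimod.surjective φ
  have hB : ∀ x, n * B k' x = 2 * B k x := fun x => by
    rw [hf x]
    exact congrArg (n * ·) (LinearMap.congr_fun hk' x)
  refine ⟨k', hunimod.injective (LinearMap.ext fun x => mul_left_cancel₀ hn ?_),
    hunimod.injective (LinearMap.ext fun x => ?_)⟩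
  · have h : B (ι k') x = B k' (ι x) := by
      rw [← hisom k' (ι x), hinvol]
    have hιx : B k (ι x) = B k x := by
      rw [← hisom k x, hk]
    change n * B (ι k') x = n * B k' x
    rw [h, hB, hB, hιx]
  · change B (n • k') x = B ((2 : ℤ) • k) x
    simpa only [map_zsmul, LinearMap.smul_apply, smul_eq_mul] using hB x
end

section
/- Let Λ = U³ ⊕ E8² ⊕ ⟨−2⟩ and let ι ∈ O(Λ) be any involution (ι² = id). Then the invariant sublattice Λ^ι is 2-elementary: for every x in the ℚ-span of Λ^ι inside Λ ⊗ ℚ with B(x,y) ∈ ℤ for all y ∈ Λ^ι, one has 2x ∈ Λ^ι. -/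
open Matrix

/-- `U(2)`, with Gram matrix `[[0,2],[2,0]]`. -/
def U2Gram : Matrix (Fin 2) (Fin 2) ℤ := !![0, 2; 2, 0]

/-- `⟨2⟩ ⊕ ⟨-2⟩`. -/
def diag2Gram : Matrix (Fin 2) (Fin 2) ℤ := !![2, 0; 0, -2]

/-- The (negative definite even unimodular) `E8` lattice: the negative of the E₈ Cartan matrix. -/
def E8Gram : Matrix (Fin 8) (Fin 8) ℤ := -CartanMatrix.E₈

/-- The rank-one lattice `⟨k⟩`. -/
def rankOneGram (k : ℤ) : Matrix (Fin 1) (Fin 1) ℤ := !![k]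

/-- The underlying module of `Λ = U³ ⊕ E8² ⊕ ⟨-2⟩`. -/
abbrev LambdaM : Type :=
  (Fin 2 → ℤ) × (Fin 2 → ℤ) × (Fin 2 → ℤ) × (Fin 8 → ℤ) × (Fin 8 → ℤ) × (Fin 1 → ℤ)

/-- The bilinear form of the Beauville–Bogomolov lattice `Λ = U³ ⊕ E8² ⊕ ⟨-2⟩`. -/
def LambdaB : LambdaM →ₗ[ℤ] LambdaM →ₗ[ℤ] ℤ :=
  prodBilin (gramBilin UGram) <| prodBilin (gramBilin UGram) <| prodBilin (gramBilin UGram) <|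
    prodBilin (gramBilin E8Gram) <| prodBilin (gramBilin E8Gram) (gramBilin (rankOneGram (-2)))

/-- Membership in `O(Λ)`: a linear automorphism preserving the form. -/
def IsIsometry (f : LambdaM ≃ₗ[ℤ] LambdaM) : Prop :=
  ∀ x y, LambdaB (f x) (f y) = LambdaB x y

/-- The invariant sublattice `Λ^ι = {x | ι x = x}`. -/
def invLattice (f : LambdaM ≃ₗ[ℤ] LambdaM) : Submodule ℤ LambdaM :=
  LinearMap.eqLocus (f : LambdaM →ₗ[ℤ] LambdaM) (LinearMap.id)

/-- A submodule of `Λ`, with the restricted form, is isometric to the lattice `(N, BN)`. -/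
def IsometricTo {N : Type*} [AddCommGroup N] [Module ℤ N]
    (K : Submodule ℤ LambdaM) (BN : N →ₗ[ℤ] N →ₗ[ℤ] ℤ) : Prop :=
  ∃ e : K ≃ₗ[ℤ] N, ∀ x y : K, BN (e x) (e y) = LambdaB (x : LambdaM) (y : LambdaM)

/-- `div_Λ(v) = d`: the ideal of values `B(v, ·)` is generated by the positive integer `d`. -/
def HasDivisibility (v : LambdaM) (d : ℤ) : Prop :=
  0 < d ∧ (∀ x, d ∣ LambdaB v x) ∧ ∃ x, LambdaB v x = d

/-- Conjugacy in `O(Λ)`: `ι' = γ ∘ ι ∘ γ⁻¹` for some isometry `γ`. -/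
def ConjInO (ι ι' : LambdaM ≃ₗ[ℤ] LambdaM) : Prop :=
  ∃ γ : LambdaM ≃ₗ[ℤ] LambdaM, IsIsometry γ ∧ ∀ x, ι' x = γ (ι (γ.symm x))

/-- A sublattice has signature (1,1): rank two, containing both an element of positive
square and an element of negative square. -/
def SigOneOne (K : Submodule ℤ LambdaM) : Prop :=
  Module.finrank ℤ K = 2 ∧ (∃ x ∈ K, 0 < LambdaB x x) ∧ (∃ x ∈ K, LambdaB x x < 0)

/-- The orthogonal complement of a submodule of `Λ`. -/
def perpOf (K : Submodule ℤ LambdaM) : Submodule ℤ LambdaM where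
  carrier := {x | ∀ s ∈ K, LambdaB x s = 0}
  add_mem' := by
    intro a b ha hb s hs
    simp [map_add, LinearMap.add_apply, ha s hs, hb s hs]
  zero_mem' := by
    intro s hs
    simp
  smul_mem' := by
    intro c a ha s hs
    simp only [_root_.map_smul, LinearMap.smul_apply, ha s hs, smul_zero]

theorem det_UGram : UGram.det = -1 := by
  simp [UGram, Matrix.det_fin_two]

theorem isUnit_det_E8Gram : IsUnit E8Gram.det := by
  rw [E8Gram, Matrix.det_neg, CartanMatrix.E₈_det]
  simp

/-- Over a unimodular Gram matrix, every coordinate function is the pairing with some vector. -/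
theorem exists_gramBilin_eq_coord {n : ℕ} {G : Matrix (Fin n) (Fin n) ℤ} (hG : IsUnit G.det)
    (i : Fin n) : ∃ z, ∀ v, gramBilin G v z = v i := by
  refine ⟨G⁻¹ *ᵥ Pi.single i 1, fun v => ?_⟩
  rw [gramBilin, Matrix.toLinearMap₂'_apply', Matrix.mulVec_mulVec, Matrix.mul_nonsing_inv _ hG,
    Matrix.one_mulVec, dotProduct_single_one]

/-- If `n` divides twice every pairing of `v` in a unimodular lattice, then `2 v` is `n` times
a lattice vector. -/
theorem exists_smul_eq_of_dvd_gramBilin {m : ℕ} {G : Matrix (Fin m) (Fin m) ℤ}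
    (hG : IsUnit G.det) {n : ℤ} {v : Fin m → ℤ} (h : ∀ y, n ∣ 2 * gramBilin G v y) :
    ∃ w : Fin m → ℤ, n • w = (2 : ℤ) • v := by
  have hc : ∀ i, n ∣ 2 * v i := fun i => by
    obtain ⟨z, hz⟩ := exists_gramBilin_eq_coord hG i
    simpa [hz] using h z
  choose w hw using hc
  exact ⟨w, funext fun i => by simp [hw i]⟩

theorem LambdaB_apply (x y : LambdaM) :
    LambdaB x y = gramBilin UGram x.1 y.1 + (gramBilin UGram x.2.1 y.2.1 +
      (gramBilin UGram x.2.2.1 y.2.2.1 + (gramBilin E8Gram x.2.2.2.1 y.2.2.2.1 +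
      (gramBilin E8Gram x.2.2.2.2.1 y.2.2.2.2.1 + -2 * x.2.2.2.2.2 0 * y.2.2.2.2.2 0)))) := by
  simp only [LambdaB, prodBilin, LinearMap.mk₂_apply]
  congr 5
  simp [gramBilin, rankOneGram, Matrix.toLinearMap₂'_apply]
  ring

theorem mem_invLattice {f : LambdaM ≃ₗ[ℤ] LambdaM} {x : LambdaM} :
    x ∈ invLattice f ↔ f x = x := Iff.rfl

theorem mem_invLattice_of_smul_mem {f : LambdaM ≃ₗ[ℤ] LambdaM} {n : ℤ} (hn : n ≠ 0) {x : LambdaM}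
    (h : n • x ∈ invLattice f) : x ∈ invLattice f := by
  rw [mem_invLattice, _root_.map_smul] at h
  exact smul_right_injective _ hn h

theorem dvd_two_mul_LambdaB {ι : LambdaM ≃ₗ[ℤ] LambdaM} (hisom : IsIsometry ι)
    (hinvol : ∀ x, ι (ι x) = x) {k : LambdaM} (hk : k ∈ invLattice ι) {n : ℤ}
    (h : ∀ y ∈ invLattice ι, n ∣ LambdaB k y) (y : LambdaM) : n ∣ 2 * LambdaB k y := by
  have hy : y + ι y ∈ invLattice ι := by
    rw [mem_invLattice, map_add, hinvol, add_comm]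
  have hB : LambdaB k (ι y) = LambdaB k y := by
    conv_lhs => rw [← mem_invLattice.1 hk]
    exact hisom k y
  simpa [hB, two_mul] using h _ hy

/-- **The invariant sublattice of any involution of `Λ = U³ ⊕ E8² ⊕ ⟨−2⟩` is 2-elementary.**
An element of the ℚ-span of `Λ^ι` in `Λ ⊗ ℚ` is written as `(1/n) • k` with `k ∈ Λ^ι` and
`n ≠ 0`; the integrality of its pairings with `Λ^ι` reads `n ∣ B(k,y)` for all `y ∈ Λ^ι`,
and the conclusion (twice the element lies in `Λ^ι`) reads `∃ k' ∈ Λ^ι, n • k' = 2 • k`. -/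
theorem invariant_sublattice_of_Lambda_two_elementary
    (ι : LambdaM ≃ₗ[ℤ] LambdaM) (hisom : IsIsometry ι) (hinvol : ∀ x, ι (ι x) = x) :
    ∀ k ∈ invLattice ι, ∀ n : ℤ, n ≠ 0 →
      (∀ y ∈ invLattice ι, n ∣ LambdaB k y) →
      ∃ k' ∈ invLattice ι, n • k' = (2 : ℤ) • k := by
  intro k hk n hn h
  have hdvd := dvd_two_mul_LambdaB hisom hinvol hk h
  have hU : IsUnit UGram.det := by simp [det_UGram]
  obtain ⟨a, b, c, d, e, t⟩ := k
  obtain ⟨a', ha⟩ := exists_smul_eq_of_dvd_gramBilin hU (n := n) (v := a) fun y => by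
    simpa [LambdaB_apply] using hdvd (y, 0, 0, 0, 0, 0)
  obtain ⟨b', hb⟩ := exists_smul_eq_of_dvd_gramBilin hU (n := n) (v := b) fun y => by
    simpa [LambdaB_apply] using hdvd (0, y, 0, 0, 0, 0)
  obtain ⟨c', hc⟩ := exists_smul_eq_of_dvd_gramBilin hU (n := n) (v := c) fun y => by
    simpa [LambdaB_apply] using hdvd (0, 0, y, 0, 0, 0)
  obtain ⟨d', hd⟩ := exists_smul_eq_of_dvd_gramBilin isUnit_det_E8Gram (n := n) (v := d)
    fun y => by simpa [LambdaB_apply] using hdvd (0, 0, 0, y, 0, 0)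
  obtain ⟨e', he⟩ := exists_smul_eq_of_dvd_gramBilin isUnit_det_E8Gram (n := n) (v := e)
    fun y => by simpa [LambdaB_apply] using hdvd (0, 0, 0, 0, y, 0)
  obtain ⟨s, hs⟩ : n ∣ 4 * t 0 := by
    have := hdvd (0, 0, 0, 0, 0, -1)
    simp [LambdaB_apply] at this
    convert this using 1
    ring
  let w : LambdaM := ((2 : ℤ) • a', (2 : ℤ) • b', (2 : ℤ) • c', (2 : ℤ) • d', (2 : ℤ) • e', ![s])
  have hw : n • w = (4 : ℤ) • (a, b, c, d, e, t) := by
    have key : ∀ {m : ℕ} {x x' : Fin m → ℤ}, n • x' = (2 : ℤ) • x →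
        n • (2 : ℤ) • x' = (4 : ℤ) • x := fun hx => by
      rw [smul_comm, hx, smul_smul]; norm_num
    have ht : n • ![s] = (4 : ℤ) • t := by
      ext i; fin_cases i; simp [hs]
    simp only [w, Prod.smul_mk, key ha, key hb, key hc, key hd, key he, ht]
  have hwmem : w ∈ invLattice ι :=
    mem_invLattice_of_smul_mem hn (hw ▸ (invLattice ι).smul_mem 4 hk)
  have hww : (4 : ℤ) ∣ LambdaB w w := by
    obtain ⟨q, hq⟩ := h w hwmem
    refine ⟨q, mul_left_cancel₀ hn ?_⟩
    calc
      n * LambdaB w w = LambdaB (n • w) w := by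
          rw [_root_.map_smul, LinearMap.smul_apply, smul_eq_mul]
      _ = n * (4 * q) := by
          rw [hw, _root_.map_smul, LinearMap.smul_apply, hq, smul_eq_mul]; ring
  have hs2 : (2 : ℤ) ∣ s := by
    refine Int.prime_two.dvd_of_dvd_pow (n := 2) ?_
    simp only [w, LambdaB_apply, _root_.map_smul, LinearMap.smul_apply, smul_eq_mul,
      Matrix.cons_val_zero] at hww
    rw [pow_two]
    rw [mul_assoc (-2) s s] at hww
    omega
  obtain ⟨u, rfl⟩ := hs2
  refine ⟨(a', b', c', d', e', ![u]), ?_, ?_⟩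
  · refine mem_invLattice_of_smul_mem two_ne_zero (n := 2) ?_
    convert hwmem using 1
    simp [w]
  · have ht : n • ![u] = (2 : ℤ) • t := by
      ext i; fin_cases i; simp; linarith
    simp only [Prod.smul_mk, ha, hb, hc, hd, he, ht]
end

section
/- Let Λ = U³ ⊕ E8² ⊕ ⟨−2⟩ and let ι ∈ O(Λ) be an involution such that the invariant sublattice Λ^ι has signature (1,1). Then Λ^ι is isometric to one of the three lattices U, U(2), or ⟨2⟩ ⊕ ⟨−2⟩. -/
open Matrix

section Forms

variable {M N : Type*} [AddCommGroup M] [AddCommGroup N]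

/-- Twice every functional is represented by a vector of `2M + ℤ g`. -/
def RepresentsTwiceDual (B : M →ₗ[ℤ] M →ₗ[ℤ] ℤ) (g : M) : Prop :=
  ∀ ψ : M →ₗ[ℤ] ℤ, ∃ (u : M) (k : ℤ), ∀ x, B ((2 : ℤ) • u + k • g) x = 2 * ψ x

theorem prodBilin_apply (BM : M →ₗ[ℤ] M →ₗ[ℤ] ℤ) (BN : N →ₗ[ℤ] N →ₗ[ℤ] ℤ) (x y : M × N) :
    prodBilin BM BN x y = BM x.1 y.1 + BN x.2 y.2 := rfl

theorem prodBilin_symm {BM : M →ₗ[ℤ] M →ₗ[ℤ] ℤ} {BN : N →ₗ[ℤ] N →ₗ[ℤ] ℤ}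
    (hM : ∀ x y, BM x y = BM y x) (hN : ∀ x y, BN x y = BN y x) (x y : M × N) :
    prodBilin BM BN x y = prodBilin BM BN y x := by
  rw [prodBilin_apply, prodBilin_apply, hM, hN]

theorem prodBilin_even {BM : M →ₗ[ℤ] M →ₗ[ℤ] ℤ} {BN : N →ₗ[ℤ] N →ₗ[ℤ] ℤ}
    (hM : ∀ x, Even (BM x x)) (hN : ∀ x, Even (BN x x)) (x : M × N) :
    Even (prodBilin BM BN x x) :=
  (hM x.1).add (hN x.2)

theorem RepresentsTwiceDual.prod {BM : M →ₗ[ℤ] M →ₗ[ℤ] ℤ} {BN : N →ₗ[ℤ] N →ₗ[ℤ] ℤ} {g : N}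
    (hM : Function.Surjective BM) (hN : RepresentsTwiceDual BN g) :
    RepresentsTwiceDual (prodBilin BM BN) (0, g) := by
  intro ψ
  obtain ⟨u, hu⟩ := hM (ψ ∘ₗ LinearMap.inl ℤ M N)
  obtain ⟨v, k, hv⟩ := hN (ψ ∘ₗ LinearMap.inr ℤ M N)
  refine ⟨(u, v), k, fun x => ?_⟩
  have h : ψ x = ψ (x.1, 0) + ψ (0, x.2) := by rw [← map_add]; simp
  have h₂ := hv x.2
  rw [prodBilin_apply, h, mul_add]
  simp_all

theorem gramBilin_symm {n : ℕ} {G : Matrix (Fin n) (Fin n) ℤ} (hG : G.IsSymm)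
    (x y : Fin n → ℤ) : gramBilin G x y = gramBilin G y x := by
  simp only [gramBilin, Matrix.toLinearMap₂'_apply']
  rw [Matrix.dotProduct_mulVec, ← Matrix.mulVec_transpose, hG.eq, dotProduct_comm]

theorem even_gramBilin_self {n : ℕ} {G : Matrix (Fin n) (Fin n) ℤ} (hG : G.IsSymm)
    (hd : ∀ i, Even (G i i)) (x : Fin n → ℤ) : Even (gramBilin G x x) := by
  induction x using Pi.single_induction with
  | zero => simp
  | add f g hf hg =>
    have : gramBilin G (f + g) (f + g)
        = gramBilin G f f + gramBilin G g g + 2 * gramBilin G f g := by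
      simp only [map_add, LinearMap.add_apply, gramBilin_symm hG g f]; ring
    rw [this]
    exact (hf.add hg).add (even_two_mul _)
  | single i m =>
    have : gramBilin G (Pi.single i m) (Pi.single i m) = m * m * G i i := by
      simp [gramBilin, Matrix.toLinearMap₂'_apply']
      ring
    rw [this]
    exact (hd i).mul_left _

theorem gramBilin_surjective {n : ℕ} {G : Matrix (Fin n) (Fin n) ℤ} (hG : IsUnit G.det) :
    Function.Surjective (gramBilin G) := by
  intro ψ
  refine ⟨(fun i => ψ (Pi.single i 1)) ᵥ* G⁻¹, ?_⟩
  refine LinearMap.pi_ext' fun i => LinearMap.ext_ring ?_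
  simp only [gramBilin, LinearMap.comp_apply, LinearMap.single_apply,
    Matrix.toLinearMap₂'_apply', Matrix.dotProduct_mulVec, Matrix.vecMul_vecMul,
    Matrix.nonsing_inv_mul _ hG, Matrix.vecMul_one, dotProduct_single_one]

/-- In a lattice whose discriminant group is generated by the class of `g / 2`, where `g` has
square `-2`, the invariant lattice `S` of an involution satisfies `2 S* ⊆ S`. -/
theorem exists_fixed_representing_two_mul [Module.Free ℤ M]
    {B : M →ₗ[ℤ] M →ₗ[ℤ] ℤ} {g : M} (hs : ∀ x y, B x y = B y x)
    (hg : ∀ x, Even (B g x)) (hgg : B g g = -2) (hrep : RepresentsTwiceDual B g)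
    (ι : M ≃ₗ[ℤ] M) (hisom : ∀ x y, B (ι x) (ι y) = B x y) (hinvol : ∀ x, ι (ι x) = x)
    (ψ : M →ₗ[ℤ] ℤ) : ∃ s, ι s = s ∧ ∀ x, ι x = x → B s x = 2 * ψ x := by
  have hnd : ∀ z, (∀ x, B z x = 0) → z = 0 := by
    intro z hz
    rw [← Module.forall_dual_apply_eq_zero_iff ℤ z]
    intro φ
    obtain ⟨u, k, h⟩ := hrep φ
    have h₁ := h z
    rw [hs, hz] at h₁
    omega
  have hadj : ∀ x y, B (ι x) y = B x (ι y) := fun x y => by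
    rw [← hisom x (ι y), hinvol]
  obtain ⟨v, k, hv⟩ : ∃ (v : M) (k : ℤ), ι g = (2 : ℤ) • v + k • g := by
    obtain ⟨φ, hφ⟩ : ∃ φ : M →ₗ[ℤ] ℤ, ∀ x, B (ι g) x = 2 * φ x := by
      have h2 : ∀ x, 2 * (B (ι g) x / 2) = B (ι g) x := fun x =>
        Int.mul_ediv_cancel' (by rw [hadj]; exact (hg _).two_dvd)
      refine ⟨{ toFun := fun x => B (ι g) x / 2, map_add' := fun x y => ?_,
                map_smul' := fun c x => ?_ }, fun x => (h2 x).symm⟩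
      · have h₁ := h2 (x + y)
        have h₂ := h2 x
        have h₃ := h2 y
        have h₄ : B (ι g) (x + y) = B (ι g) x + B (ι g) y := map_add _ _ _
        omega
      · have h₁ := h2 (c • x)
        have h₂ := h2 x
        have h₃ : B (ι g) (c • x) = c * B (ι g) x := by simp
        apply mul_left_cancel₀ (two_ne_zero : (2 : ℤ) ≠ 0)
        rw [h₁, h₃]
        simp only [RingHom.id_apply, smul_eq_mul]
        rw [mul_left_comm, h₂]
    obtain ⟨v, k, h⟩ := hrep φ
    refine ⟨v, k, ?_⟩
    rw [← sub_eq_zero]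
    refine hnd _ fun x => ?_
    rw [map_sub, LinearMap.sub_apply, hφ, h, sub_self]
  have hk : Odd k := by
    have h₁ : B (ι g) (ι g) = -2 := by rw [hisom, hgg]
    have h₂ : B (ι g) (ι g) = 4 * B v v + 4 * k * B g v - 2 * (k * k) := by
      rw [hv]
      simp only [map_add, LinearMap.add_apply, _root_.map_smul, LinearMap.smul_apply, smul_eq_mul,
        hgg, hs v g]
      ring
    have h₃ : k * k = 2 * (B v v + k * B g v) + 1 := by linarith
    exact (Int.odd_mul.mp ⟨_, h₃⟩).1
  obtain ⟨l, hl⟩ := hk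
  obtain ⟨u, m, hu⟩ := hrep ψ
  set s : M := u + ι u + m • (v + (l + 1) • g) with hs_def
  have hy : (2 : ℤ) • s = ((2 : ℤ) • u + m • g) + ι ((2 : ℤ) • u + m • g) := by
    rw [map_add, _root_.map_smul, _root_.map_smul, hv, hl, hs_def]
    module
  refine ⟨s, ?_, fun x hx => ?_⟩
  · have : (2 : ℤ) • ι s = (2 : ℤ) • s := by
      rw [← _root_.map_smul, hy, map_add, hinvol, add_comm]
    have hfree : (2 : ℤ) • (ι s - s) = 0 := by rw [smul_sub, this, sub_self]
    exact sub_eq_zero.mp ((smul_eq_zero.mp hfree).resolve_left two_ne_zero)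
  · have h₁ : B ((2 : ℤ) • s) x = 2 * (2 * ψ x) := by
      rw [hy, map_add, LinearMap.add_apply, hadj, hx, hu]; ring
    rw [_root_.map_smul, LinearMap.smul_apply, smul_eq_mul] at h₁
    linarith

/-- The kernel of an endomorphism of a finite free `ℤ`-module is a direct summand,
so functionals extend from it. -/
theorem exists_extend_dual_of_ker [Module.Free ℤ M] [Module.Finite ℤ M] (f : M →ₗ[ℤ] M)
    (φ : LinearMap.ker f →ₗ[ℤ] ℤ) :
    ∃ ψ : M →ₗ[ℤ] ℤ, ∀ x : LinearMap.ker f, ψ x = φ x := by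
  obtain ⟨s, hs⟩ := f.rangeRestrict.exists_rightInverse_of_surjective f.range_rangeRestrict
  have hs' : ∀ y, f (s y) = y := fun y => congrArg Subtype.val (LinearMap.congr_fun hs y)
  have hmem : ∀ x : M, (LinearMap.id - s ∘ₗ f.rangeRestrict : M →ₗ[ℤ] M) x ∈ LinearMap.ker f :=
    fun x => by simp [hs']
  refine ⟨φ ∘ₗ LinearMap.codRestrict (LinearMap.ker f) _ hmem, ?_⟩
  rintro ⟨x, hx⟩
  have : f.rangeRestrict x = 0 := Subtype.ext hx
  simp only [LinearMap.comp_apply]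
  congr 1
  ext1
  simp [this]

end Forms

section Binary

/-- A binary form of discriminant `-1` has a basis with Gram matrix `[[0,1],[1,ε]]`,
`ε ∈ {0, 1}`. -/
theorem exists_reduced_basis {a b c : ℤ} (h : b * b - a * c = 1) :
    ∃ x y z w : ℤ, IsUnit (x * w - y * z) ∧
      a * x * x + 2 * b * x * y + c * y * y = 0 ∧
      a * x * z + b * (x * w + y * z) + c * y * w = 1 ∧
      (a * z * z + 2 * b * z * w + c * w * w = 0 ∨
        a * z * z + 2 * b * z * w + c * w * w = 1) := by
  obtain ⟨x, y, hco, hxy⟩ : ∃ x y : ℤ, IsCoprime x y ∧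
      a * x * x + 2 * b * x * y + c * y * y = 0 := by
    by_cases ha : a = 0
    · exact ⟨1, 0, isCoprime_one_left, by simp [ha]⟩
    · have hpos : 0 < Int.gcd (1 - b) a := Int.gcd_pos_of_ne_zero_right _ ha
      obtain ⟨x, y, hco, hx, hy⟩ := Int.exists_gcd_one hpos
      refine ⟨x, y, Int.isCoprime_iff_gcd_eq_one.mpr hco, ?_⟩
      have hd : (Int.gcd (1 - b) a : ℤ) ≠ 0 := by exact_mod_cast hpos.ne'
      set d : ℤ := (Int.gcd (1 - b) a : ℤ)
      have : d * d * (a * x * x + 2 * b * x * y + c * y * y) = 0 := by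
        calc _ = a * (x * d) * (x * d) + 2 * b * (x * d) * (y * d) + c * (y * d) * (y * d) := by
              ring
          _ = 0 := by rw [← hx, ← hy]; linear_combination (-a) * h
      exact (mul_eq_zero.mp this).resolve_left (mul_ne_zero hd hd)
  obtain ⟨w, t, hwt⟩ := hco
  set β := a * x * (-t) + b * (x * w + y * (-t)) + c * y * w with hβ
  set γ := a * t * t - 2 * b * t * w + c * w * w with hγ
  have hβ2 : β * β = 1 := by
    have : β * β = (a * x * x + 2 * b * x * y + c * y * y) * γ
        + (b * b - a * c) * (w * x + t * y) ^ 2 := by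
      rw [hβ, hγ]; ring
    rw [this, hxy, h, hwt]; ring
  refine ⟨β * x, β * y, -t - γ / 2 * (β * x), w - γ / 2 * (β * y), ?_, ?_, ?_, ?_⟩
  · have : β * x * (w - γ / 2 * (β * y)) - β * y * (-t - γ / 2 * (β * x)) = β := by
      linear_combination β * hwt
    rw [this]
    exact IsUnit.of_mul_eq_one _ hβ2
  · linear_combination β * β * hxy
  · linear_combination hβ2 - γ / 2 * β * β * hxy + β * hβ
  · have : a * (-t - γ / 2 * (β * x)) * (-t - γ / 2 * (β * x))
        + 2 * b * (-t - γ / 2 * (β * x)) * (w - γ / 2 * (β * y))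
        + c * (w - γ / 2 * (β * y)) * (w - γ / 2 * (β * y)) = γ - 2 * (γ / 2) := by
      linear_combination (γ / 2) ^ 2 * β * β * hxy - 2 * (γ / 2) * hβ2 - hγ
        + 2 * (γ / 2) * β * hβ
    rw [this]
    omega

end Binary

section Lattice

variable {K : Submodule ℤ LambdaM}

theorem isometricTo_of_basis (b : Module.Basis (Fin 2) ℤ K) {G : Matrix (Fin 2) (Fin 2) ℤ}
    (hG : ∀ i j, LambdaB (b i : LambdaM) (b j : LambdaM) = G i j) :
    IsometricTo K (gramBilin G) := by
  refine ⟨b.equivFun, fun x y => ?_⟩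
  have : (gramBilin G).compl₁₂ b.equivFun.toLinearMap b.equivFun.toLinearMap
      = LambdaB.compl₁₂ K.subtype K.subtype := by
    refine LinearMap.ext_basis b b fun i j => ?_
    simp [gramBilin, hG, LinearMap.compl₁₂_apply, Matrix.toLinearMap₂'_apply',
      Module.Basis.equivFun_apply, Finsupp.single_eq_pi_single]
  exact LinearMap.congr_fun (LinearMap.congr_fun this x) y

/-- Change of basis by an integer matrix of unit determinant. -/
theorem exists_basis_of_isUnit (b : Module.Basis (Fin 2) ℤ K) {x y z w : ℤ}
    (h : IsUnit (x * w - y * z)) :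
    ∃ b' : Module.Basis (Fin 2) ℤ K,
      b' 0 = x • b 0 + y • b 1 ∧ b' 1 = z • b 0 + w • b 1 := by
  have hdet : IsUnit (!![x, z; y, w] : Matrix (Fin 2) (Fin 2) ℤ).det := by
    rw [Matrix.det_fin_two_of]
    convert h using 1
    ring
  refine ⟨b.map (Matrix.toLinearEquiv b _ hdet), ?_, ?_⟩ <;>
    simp [Matrix.toLin_self]

theorem LambdaB_symm (x y : LambdaM) : LambdaB x y = LambdaB y x :=
  prodBilin_symm (gramBilin_symm (by decide)) (prodBilin_symm (gramBilin_symm (by decide))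
    (prodBilin_symm (gramBilin_symm (by decide)) (prodBilin_symm (gramBilin_symm (by decide))
      (prodBilin_symm (gramBilin_symm (by decide)) (gramBilin_symm (by decide)))))) x y

theorem even_LambdaB_self (x : LambdaM) : Even (LambdaB x x) := by
  have hU := even_gramBilin_self (G := UGram) (by decide) (by decide)
  have hE := even_gramBilin_self (G := E8Gram) (by decide) (by decide)
  have hR := even_gramBilin_self (G := rankOneGram (-2)) (by decide) (by decide)
  exact prodBilin_even hU (prodBilin_even hU (prodBilin_even hU
    (prodBilin_even hE (prodBilin_even hE hR)))) x

/-- The generator of the summand `⟨-2⟩` of `Λ`. -/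
def LambdaGen : LambdaM := (0, 0, 0, 0, 0, fun _ => 1)

theorem LambdaB_gen (x : LambdaM) : LambdaB LambdaGen x = -2 * x.2.2.2.2.2 0 := by
  simp [LambdaB, LambdaGen, prodBilin_apply, gramBilin, rankOneGram,
    Matrix.toLinearMap₂'_apply', dotProduct]

theorem LambdaB_representsTwiceDual : RepresentsTwiceDual LambdaB LambdaGen := by
  have hU : Function.Surjective (gramBilin UGram) :=
    gramBilin_surjective (by simp [UGram, Matrix.det_fin_two_of])
  have hE : Function.Surjective (gramBilin E8Gram) :=
    gramBilin_surjective (by simp [E8Gram, Matrix.det_neg, CartanMatrix.E₈_det])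
  have hR : RepresentsTwiceDual (gramBilin (rankOneGram (-2))) (fun _ => 1) := by
    intro ψ
    refine ⟨0, -ψ (fun _ => 1), fun x => ?_⟩
    have hx : x = x 0 • (fun _ => 1) := by
      ext i
      simp [Subsingleton.elim i 0]
    have h : ψ x = x 0 * ψ (fun _ => 1) := by
      conv_lhs => rw [hx]
      rw [_root_.map_smul, smul_eq_mul]
    rw [h]
    simp [gramBilin, rankOneGram, Matrix.toLinearMap₂'_apply', dotProduct]
    ring
  exact .prod hU (.prod hU (.prod hU (.prod hE (.prod hE hR))))

/-- The form on `K` in coordinates. -/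
theorem LambdaB_combination (u v : LambdaM) (x y z w : ℤ) :
    LambdaB (x • u + y • v) (z • u + w • v)
      = LambdaB u u * x * z + LambdaB u v * (x * w + y * z) + LambdaB v v * y * w := by
  simp only [map_add, LinearMap.add_apply, _root_.map_smul, LinearMap.smul_apply, smul_eq_mul,
    LambdaB_symm v u]
  ring

/-- A lattice with Gram matrix `k` times a unimodular matrix of determinant `-1` is isometric
to `U(k)` or to `⟨k⟩ ⊕ ⟨-k⟩`. -/
theorem isometricTo_scaled_unimodular (e : Module.Basis (Fin 2) ℤ K) {k a b c : ℤ}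
    (ha : LambdaB (e 0 : LambdaM) (e 0 : LambdaM) = k * a)
    (hb : LambdaB (e 0 : LambdaM) (e 1 : LambdaM) = k * b)
    (hc : LambdaB (e 1 : LambdaM) (e 1 : LambdaM) = k * c) (h : b * b - a * c = 1) :
    IsometricTo K (gramBilin !![0, k; k, 0]) ∨
      IsometricTo K (gramBilin !![k, 0; 0, -k]) := by
  obtain ⟨x, y, z, w, hu, h₀₀, h₀₁, h₁₁⟩ := exists_reduced_basis h
  obtain ⟨f, hf₀, hf₁⟩ := exists_basis_of_isUnit e hu
  have g₀₀ : LambdaB (f 0 : LambdaM) (f 0 : LambdaM) = 0 := by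
    rw [hf₀]; push_cast
    rw [LambdaB_combination, ha, hb, hc]; linear_combination k * h₀₀
  have g₀₁ : LambdaB (f 0 : LambdaM) (f 1 : LambdaM) = k := by
    rw [hf₀, hf₁]; push_cast
    rw [LambdaB_combination, ha, hb, hc]; linear_combination k * h₀₁
  rcases h₁₁ with h₁₁ | h₁₁
  · left
    have g₁₁ : LambdaB (f 1 : LambdaM) (f 1 : LambdaM) = 0 := by
      rw [hf₁]; push_cast
      rw [LambdaB_combination, ha, hb, hc]; linear_combination k * h₁₁
    refine isometricTo_of_basis f fun i j => ?_
    fin_cases i <;> fin_cases j <;> simp [g₀₀, g₀₁, g₁₁, LambdaB_symm (f 1 : LambdaM) (f 0)]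
  · right
    have g₁₁ : LambdaB (f 1 : LambdaM) (f 1 : LambdaM) = k := by
      rw [hf₁]; push_cast
      rw [LambdaB_combination, ha, hb, hc]; linear_combination k * h₁₁
    obtain ⟨p, hp₀, hp₁⟩ := exists_basis_of_isUnit f
      (x := 0) (y := 1) (z := 1) (w := -1) (by decide)
    refine isometricTo_of_basis p fun i j => ?_
    fin_cases i <;> fin_cases j <;>
      simp only [Fin.zero_eta, Fin.mk_one, hp₀, hp₁, Submodule.coe_add, Submodule.coe_smul,
        LambdaB_combination, g₀₀, g₀₁, g₁₁] <;> simp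
    ring

theorem isometricTo_of_two_elementary (e : Module.Basis (Fin 2) ℤ K)
    (hpos : ∃ x ∈ K, 0 < LambdaB x x) (hneg : ∃ x ∈ K, LambdaB x x < 0)
    (hdual : ∀ φ : K →ₗ[ℤ] ℤ, ∃ s : K, ∀ x : K, LambdaB (s : LambdaM) x = 2 * φ x) :
    IsometricTo K (gramBilin UGram) ∨ IsometricTo K (gramBilin U2Gram) ∨
      IsometricTo K (gramBilin diag2Gram) := by
  obtain ⟨a, ha⟩ := even_iff_two_dvd.mp (even_LambdaB_self (e 0))
  obtain ⟨c, hc⟩ := even_iff_two_dvd.mp (even_LambdaB_self (e 1))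
  obtain ⟨b, hb⟩ : ∃ b, LambdaB (e 0 : LambdaM) (e 1 : LambdaM) = b := ⟨_, rfl⟩
  have hrepr : ∀ s : K, ∃ x y : ℤ, s = x • e 0 + y • e 1 := fun s =>
    ⟨e.repr s 0, e.repr s 1, by rw [← Fin.sum_univ_two (fun i => e.repr s i • e i), e.sum_repr]⟩
  have hpair : ∀ s : K, ∃ x y : ℤ, LambdaB (s : LambdaM) (e 0) = 2 * a * x + b * y ∧
      LambdaB (s : LambdaM) (e 1) = b * x + 2 * c * y ∧
      LambdaB (s : LambdaM) s = 2 * (a * x * x + b * x * y + c * y * y) := by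
    intro s
    obtain ⟨x, y, rfl⟩ := hrepr s
    refine ⟨x, y, ?_, ?_, ?_⟩
    · have := LambdaB_combination (e 0) (e 1) x y 1 0
      rw [ha, hb, hc, one_smul, zero_smul, add_zero] at this
      push_cast
      rw [this]; ring
    · have := LambdaB_combination (e 0) (e 1) x y 0 1
      rw [ha, hb, hc, one_smul, zero_smul, zero_add] at this
      push_cast
      rw [this]; ring
    · push_cast
      rw [LambdaB_combination, ha, hb, hc]; ring
  obtain ⟨s, hs⟩ := hdual (e.coord 0)
  obtain ⟨t, ht⟩ := hdual (e.coord 1)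
  obtain ⟨p, q, hs₀, hs₁, -⟩ := hpair s
  obtain ⟨r, u, ht₀, ht₁, -⟩ := hpair t
  rw [hs] at hs₀ hs₁
  rw [ht] at ht₀ ht₁
  simp at hs₀ hs₁ ht₀ ht₁
  have hdet : (b * b - 4 * a * c) * (r * q - p * u) = 4 := by
    linear_combination (-(b * r + 2 * c * u)) * hs₀ + (2 * a * r + b * u) * hs₁ - 2 * ht₁
  have hind : 0 < b * b - 4 * a * c := by
    by_contra! hcon
    obtain ⟨v, hvK, hv⟩ := hpos
    obtain ⟨v', hvK', hv'⟩ := hneg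
    obtain ⟨x, y, -, -, hxy⟩ := hpair ⟨v, hvK⟩
    obtain ⟨x', y', -, -, hxy'⟩ := hpair ⟨v', hvK'⟩
    simp only at hxy hxy'
    have hp : 0 < a * x * x + b * x * y + c * y * y := by linarith
    have hn : a * x' * x' + b * x' * y' + c * y' * y' < 0 := by linarith
    have i₁ : ∀ x y, 0 ≤ a * (a * x * x + b * x * y + c * y * y) := fun x y => by
      nlinarith [sq_nonneg (2 * a * x + b * y),
        mul_nonneg (sub_nonneg.mpr hcon) (sq_nonneg y)]
    have i₂ : ∀ x y, 0 ≤ c * (a * x * x + b * x * y + c * y * y) := fun x y => by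
      nlinarith [sq_nonneg (2 * c * y + b * x),
        mul_nonneg (sub_nonneg.mpr hcon) (sq_nonneg x)]
    have ha0 : a = 0 := by
      have := i₁ x y
      have := i₁ x' y'
      nlinarith
    have hc0 : c = 0 := by
      have := i₂ x y
      have := i₂ x' y'
      nlinarith
    have hb0 : b = 0 := by
      rw [ha0] at hcon
      nlinarith
    simp [ha0, hb0, hc0] at hp
  have hle : b * b - 4 * a * c ≤ 4 := Int.le_of_dvd (by norm_num) ⟨_, hdet.symm⟩
  obtain ⟨d, hd⟩ : ∃ d, d = b * b - 4 * a * c := ⟨_, rfl⟩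
  have hmod : d % 4 = 0 ∨ d % 4 = 1 := by
    have h4 : d = b * b - 4 * (a * c) := by rw [hd]; ring
    rcases Int.even_or_odd' b with ⟨m, hm | hm⟩
    · have : d = 4 * (m * m - a * c) := by rw [h4, hm]; ring
      omega
    · have : d = 4 * (m * m + m - a * c) + 1 := by rw [h4, hm]; ring
      omega
  rw [← hd] at hind hle hdet
  have hcases : d = 1 ∨ d = 4 := by omega
  rcases hcases with rfl | rfl
  · rcases isometricTo_scaled_unimodular e (k := 1) (a := 2 * a) (b := b) (c := 2 * c)
      (by rw [ha]; ring) (by rw [hb]; ring) (by rw [hc]; ring) (by rw [hd]; ring)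
      with hU | ⟨E, hE⟩
    · exact Or.inl hU
    · have h₁ := hE (E.symm ![1, 0]) (E.symm ![1, 0])
      have h₂ := even_LambdaB_self (E.symm ![1, 0] : K)
      rw [← h₁] at h₂
      simp [gramBilin, Matrix.toLinearMap₂'_apply', Matrix.vecHead] at h₂
  · right
    obtain ⟨m, rfl⟩ : Even b := by
      have h4 : Even (b * b) := ⟨2 + 2 * (a * c), by linear_combination -hd⟩
      simpa using Int.even_mul.mp h4
    exact isometricTo_scaled_unimodular e (k := 2) (a := a) (b := m) (c := c)
      ha (by rw [hb]; ring) hc (by linarith)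

end Lattice

/-- If `ι ∈ O(Λ)` is an involution of `Λ = U³ ⊕ E8² ⊕ ⟨−2⟩` whose invariant sublattice
has signature `(1,1)`, then `Λ^ι` is isometric to `U`, `U(2)` or `⟨2⟩ ⊕ ⟨−2⟩`. -/
theorem invariant_sublattice_classification
    (ι : LambdaM ≃ₗ[ℤ] LambdaM) (hisom : IsIsometry ι) (hinvol : ∀ x, ι (ι x) = x)
    (hsig : SigOneOne (invLattice ι)) :
    IsometricTo (invLattice ι) (gramBilin UGram) ∨
    IsometricTo (invLattice ι) (gramBilin U2Gram) ∨
    IsometricTo (invLattice ι) (gramBilin diag2Gram) := by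
  obtain ⟨hrank, hpos, hneg⟩ := hsig
  have hfin : Module.finrank ℤ (invLattice ι) = 2 := hrank
  refine isometricTo_of_two_elementary (Module.finBasisOfFinrankEq ℤ _ hfin) hpos hneg ?_
  intro φ
  have hker : invLattice ι = LinearMap.ker ((ι : LambdaM →ₗ[ℤ] LambdaM) - LinearMap.id) :=
    LinearMap.eqLocus_eq_ker_sub _ _
  have hext : ∃ ψ : LambdaM →ₗ[ℤ] ℤ, ∀ x : invLattice ι, ψ x = φ x := by
    generalize invLattice ι = K at hker φ
    subst hker
    exact exists_extend_dual_of_ker _ φ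
  obtain ⟨ψ, hψ⟩ := hext
  obtain ⟨s, hs, h⟩ := exists_fixed_representing_two_mul LambdaB_symm
    (fun x => by rw [LambdaB_gen]; exact (by decide : Even (-2 : ℤ)).mul_right _)
    (by rw [LambdaB_gen]; rfl) LambdaB_representsTwiceDual ι hisom hinvol ψ
  exact ⟨⟨s, hs⟩, fun x => by rw [← hψ]; exact h x x.2⟩
end

section
/- Let Λ = U³ ⊕ E8² ⊕ ⟨−2⟩ and let ι, ι′ ∈ O(Λ) be involutions whose invariant sublattices Λ^ι and Λ^{ι′} are both isometric to U. Then ι and ι′ are conjugate in O(Λ): there exists γ ∈ O(Λ) with ι′ = γ ∘ ι ∘ γ⁻¹. -/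
open Matrix

namespace BilinIsometry

variable {M : Type*} [AddCommGroup M]

/-- The group of linear automorphisms preserving a bilinear form. -/
def isometryGroup (B : M →ₗ[ℤ] M →ₗ[ℤ] ℤ) : Subgroup (M ≃ₗ[ℤ] M) where
  carrier := {g | ∀ x y, B (g x) (g y) = B x y}
  one_mem' := fun _ _ => rfl
  mul_mem' := fun {g h} hg hh x y => (hg (h x) (h y)).trans (hh x y)
  inv_mem' := fun {g} hg x y => by
    have h := hg (g⁻¹ x) (g⁻¹ y)
    rw [← LinearEquiv.mul_apply, ← LinearEquiv.mul_apply, mul_inv_cancel] at h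
    exact h.symm

theorem mem_isometryGroup {B : M →ₗ[ℤ] M →ₗ[ℤ] ℤ} {g : M ≃ₗ[ℤ] M} :
    g ∈ isometryGroup B ↔ ∀ x y, B (g x) (g y) = B x y := Iff.rfl

theorem isometryGroup_inv_apply {B : M →ₗ[ℤ] M →ₗ[ℤ] ℤ} {g : M ≃ₗ[ℤ] M}
    (hg : g ∈ isometryGroup B) (x y : M) : B x (g y) = B (g⁻¹ x) y := by
  have h := hg (g⁻¹ x) y
  rwa [← LinearEquiv.mul_apply, mul_inv_cancel] at h

/-- The linear map underlying the Eichler transvection attached to `e` and `a`, where `q` is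
half the square of `a`. -/
def transvectionMap (B : M →ₗ[ℤ] M →ₗ[ℤ] ℤ) (e a : M) (q : ℤ) : M →ₗ[ℤ] M :=
  LinearMap.id - (B a).smulRight e + (B e).smulRight a - (q • B e).smulRight e

theorem transvectionMap_apply (B : M →ₗ[ℤ] M →ₗ[ℤ] ℤ) (e a : M) (q : ℤ) (x : M) :
    transvectionMap B e a q x = x - B a x • e + B e x • a - (q * B e x) • e := by
  simp [transvectionMap]

theorem transvectionMap_neg_apply {B : M →ₗ[ℤ] M →ₗ[ℤ] ℤ} (hB : ∀ x y, B x y = B y x)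
    {e a : M} {q : ℤ} (he : B e e = 0) (hea : B e a = 0) (hq : B a a = 2 * q) (x : M) :
    transvectionMap B e (-a) q (transvectionMap B e a q x) = x := by
  have hae : B a e = 0 := by rw [hB, hea]
  simp only [transvectionMap_apply, map_sub, map_add, _root_.map_smul, map_neg,
    LinearMap.neg_apply, he, hea, hae, hq]
  module

/-- The Eichler transvection attached to an isotropic vector `e` and a vector `a` orthogonal
to `e`. -/
theorem exists_transvection {B : M →ₗ[ℤ] M →ₗ[ℤ] ℤ} (hB : ∀ x y, B x y = B y x)
    {e a : M} {q : ℤ} (he : B e e = 0) (hea : B e a = 0) (hq : B a a = 2 * q) :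
    ∃ g ∈ isometryGroup B, ∀ x, g x = x - B a x • e + B e x • a - (q * B e x) • e := by
  have hae : B a e = 0 := by rw [hB, hea]
  refine ⟨LinearEquiv.ofLinearMap (transvectionMap B e a q) (transvectionMap B e (-a) q)
    (LinearMap.ext fun x => ?_)
    (LinearMap.ext fun x => transvectionMap_neg_apply hB he hea hq x),
    fun x y => ?_, transvectionMap_apply B e a q⟩
  · have h := transvectionMap_neg_apply (a := -a) hB he (by simp [hea]) (by simpa using hq) x
    rwa [neg_neg] at h
  · simp only [LinearEquiv.coe_ofLinearMap, transvectionMap_apply, map_sub, map_add,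
      _root_.map_smul, LinearMap.sub_apply, LinearMap.add_apply, LinearMap.smul_apply,
      he, hea, hae, hq, smul_eq_mul, hB x e, hB x a]
    ring

/-- A hyperbolic pair: isotropic vectors with product one. -/
structure IsHyperbolicPair (B : M →ₗ[ℤ] M →ₗ[ℤ] ℤ) (e f : M) : Prop where
  left : B e e = 0
  right : B f f = 0
  pair : B e f = 1

/-- Two mutually orthogonal hyperbolic pairs. -/
structure IsHyperbolicQuadruple (B : M →ₗ[ℤ] M →ₗ[ℤ] ℤ) (e f e₁ f₁ : M) : Prop where
  fst : IsHyperbolicPair B e f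
  snd : IsHyperbolicPair B e₁ f₁
  ee : B e e₁ = 0
  ef : B e f₁ = 0
  fe : B f e₁ = 0
  ff : B f f₁ = 0

section

variable {B : M →ₗ[ℤ] M →ₗ[ℤ] ℤ}

theorem IsHyperbolicPair.symm (hB : ∀ x y, B x y = B y x) {e f : M}
    (h : IsHyperbolicPair B e f) : IsHyperbolicPair B f e :=
  ⟨h.right, h.left, (hB f e).trans h.pair⟩

theorem IsHyperbolicQuadruple.swap (hB : ∀ x y, B x y = B y x) {e f e₁ f₁ : M}
    (h : IsHyperbolicQuadruple B e f e₁ f₁) : IsHyperbolicQuadruple B e₁ f₁ e f :=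
  ⟨h.snd, h.fst, (hB _ _).trans h.ee, (hB _ _).trans h.fe, (hB _ _).trans h.ef,
    (hB _ _).trans h.ff⟩

theorem IsHyperbolicQuadruple.symm_snd (hB : ∀ x y, B x y = B y x) {e f e₁ f₁ : M}
    (h : IsHyperbolicQuadruple B e f e₁ f₁) : IsHyperbolicQuadruple B e f f₁ e₁ :=
  ⟨h.fst, h.snd.symm hB, h.ef, h.ee, h.ff, h.fe⟩

theorem IsHyperbolicPair.map {e f : M} (h : IsHyperbolicPair B e f) {g : M ≃ₗ[ℤ] M}
    (hg : g ∈ isometryGroup B) : IsHyperbolicPair B (g e) (g f) :=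
  ⟨(hg e e).trans h.left, (hg f f).trans h.right, (hg e f).trans h.pair⟩

theorem IsHyperbolicQuadruple.exists_map_eq (hB : ∀ x y, B x y = B y x) {e f e₁ f₁ : M}
    (h : IsHyperbolicQuadruple B e f e₁ f₁) : ∃ g ∈ isometryGroup B, g f = f₁ := by
  obtain ⟨⟨hee, hff, hef⟩, ⟨hee₁, hff₁, hef₁⟩, h1, h2, h3, h4⟩ := h
  obtain ⟨s, hs, hs'⟩ := exists_transvection (q := 0) hB hee h2 (by simpa using hff₁)
  obtain ⟨t, ht, ht'⟩ := exists_transvection (a := -f) (q := 0) hB hee₁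
    (by simp [hB e₁ f, h3]) (by simp [hff])
  refine ⟨t * s, mul_mem ht hs, ?_⟩
  simp [LinearEquiv.mul_apply, hs', ht', hB f₁ f, hB e₁ f, hff, hef, hef₁, h3, h4]

/-- An isotropic vector pairing to one with `f` can be moved to the partner of `f` by an
isometry fixing `f`. -/
theorem IsHyperbolicPair.exists_map_left_eq (hB : ∀ x y, B x y = B y x)
    (heven : ∀ x, Even (B x x)) {e f v : M} (h : IsHyperbolicPair B e f)
    (hv : IsHyperbolicPair B v f) : ∃ g ∈ isometryGroup B, g v = e ∧ g f = f := by
  obtain ⟨hee, hff, hef⟩ := h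
  obtain ⟨hvv, -, hvf⟩ := hv
  have hfe : B f e = 1 := (hB _ _).trans hef
  have hfv : B f v = 1 := (hB _ _).trans hvf
  obtain ⟨q, hq⟩ := heven (e + B e v • f - v)
  obtain ⟨g, hg, hg'⟩ := exists_transvection (e := f) (a := e + B e v • f - v) (q := q) hB hff
    (by simp [hff, hfe, hfv]) (by rw [hq]; ring)
  refine ⟨g, hg, ?_, ?_⟩
  · have hq' : q = -B e v := by
      have : q + q = 2 * -B e v := by
        rw [← hq]
        simp [hee, hff, hef, hfe, hfv, hvv, hvf, hB v e]
        ring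
      linarith
    rw [hg']
    simp only [map_sub, map_add, _root_.map_smul, LinearMap.sub_apply, LinearMap.add_apply,
      LinearMap.smul_apply, hfv, hvv, smul_eq_mul, hq']
    module
  · rw [hg']
    simp [hff, hef, hvf]

/-- The values taken by `B f` on the orbit of `v`. -/
def orbitValues (B : M →ₗ[ℤ] M →ₗ[ℤ] ℤ) (f v : M) : Set ℤ :=
  {c | ∃ g ∈ isometryGroup B, B f (g v) = c}

theorem mem_orbitValues_of_map {f u v : M} {g k : M ≃ₗ[ℤ] M} (hk : k ∈ isometryGroup B)
    (hku : k f = u) (hg : g ∈ isometryGroup B) : B u (g v) ∈ orbitValues B f v := by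
  refine ⟨k⁻¹ * g, mul_mem (inv_mem hk) hg, ?_⟩
  rw [LinearEquiv.mul_apply, isometryGroup_inv_apply (inv_mem hk), inv_inv, hku]

/-- An integer of least nonzero absolute value in a set, or zero if there is none. -/
theorem exists_minimal_natAbs {S : Set ℤ} (hS : S.Nonempty) :
    ∃ p ∈ S, ∀ c ∈ S, c ≠ 0 → p ≠ 0 ∧ p.natAbs ≤ c.natAbs := by
  by_cases h : ∃ c ∈ S, c ≠ 0
  · obtain ⟨p, ⟨hp, hp0⟩, hmin⟩ :=
      (measure Int.natAbs).wf.has_min {c | c ∈ S ∧ c ≠ 0} h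
    exact ⟨p, hp, fun c hc hc0 => ⟨hp0, not_lt.mp (hmin c ⟨hc, hc0⟩)⟩⟩
  · push Not at h
    obtain ⟨c, hc⟩ := hS
    exact ⟨c, hc, fun d hd hd0 => absurd (h d hd) hd0⟩

theorem IsHyperbolicQuadruple.dvd_of_minimal (hB : ∀ x y, B x y = B y x) {e f e₁ f₁ v : M}
    (h : IsHyperbolicQuadruple B e f e₁ f₁) {p : ℤ}
    (hmin : ∀ c ∈ orbitValues B f v, c ≠ 0 → p ≠ 0 ∧ p.natAbs ≤ c.natAbs)
    {g : M ≃ₗ[ℤ] M} (hg : g ∈ isometryGroup B) (hgp : B f (g v) = p) :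
    ∃ t ∈ isometryGroup B, B f (t v) = p ∧ B e₁ (t v) = 0 ∧ p ∣ B e₁ (g v) := by
  set r := B e₁ (g v) with hr
  obtain ⟨t, ht, ht'⟩ := exists_transvection (e := f) (a := (-(r / p)) • f₁) (q := 0) hB
    h.fst.right (by simp [h.ff]) (by simp [h.snd.right])
  have hval : B e₁ ((t * g) v) = r % p := by
    rw [LinearEquiv.mul_apply, ht', Int.emod_def]
    simp [hB e₁ f, h.fe, h.snd.pair, hgp, ← hr]
    ring
  obtain ⟨k, hk, hk'⟩ := (h.symm_snd hB).exists_map_eq hB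
  have hmem := mem_orbitValues_of_map (v := v) hk hk' (mul_mem ht hg)
  have h0 : r % p = 0 := by
    by_contra hne
    rw [hval] at hmem
    obtain ⟨hp0, hle⟩ := hmin _ hmem hne
    have h1 := Int.emod_nonneg r hp0
    have h2 := Int.emod_lt_abs r hp0
    rw [Int.abs_eq_natAbs] at h2
    omega
  refine ⟨t * g, mul_mem ht hg, ?_, hval.trans h0, Int.dvd_of_emod_eq_zero h0⟩
  rw [LinearEquiv.mul_apply, ht']
  simp [h.fst.right, h.ff, hgp]

theorem IsHyperbolicQuadruple.exists_map_pairing_eq_one (hB : ∀ x y, B x y = B y x)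
    (heven : ∀ x, Even (B x x)) {e f e₁ f₁ v w : M}
    (h : IsHyperbolicQuadruple B e f e₁ f₁) (hw : B v w = 1) :
    ∃ g ∈ isometryGroup B, B f (g v) = 1 := by
  obtain ⟨p, ⟨g₀, hg₀, hp₀⟩, hmin⟩ :=
    exists_minimal_natAbs (S := orbitValues B f v) ⟨_, 1, one_mem _, rfl⟩
  obtain ⟨g, hg, hgp, hg0, -⟩ := h.dvd_of_minimal hB hmin hg₀ hp₀
  have hdvd : ∀ t ∈ isometryGroup B, B f (t v) = p → p ∣ B f₁ (t v) := fun t ht htp =>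
    ((h.symm_snd hB).dvd_of_minimal hB hmin ht htp).choose_spec.2.2.2
  have hperp : ∀ x, B e₁ x = 0 → p ∣ B x (g v) := fun x hx => by
    obtain ⟨q, hq⟩ := heven x
    obtain ⟨t, ht, ht'⟩ := exists_transvection (q := q) hB h.snd.left hx (by rw [hq]; ring)
    have h1 := hdvd (t * g) (mul_mem ht hg) (by
      rw [LinearEquiv.mul_apply, ht']
      simp [h.fe, hg0, hgp])
    have h2 : B f₁ ((t * g) v) = B f₁ (g v) - B x (g v) := by
      rw [LinearEquiv.mul_apply, ht']
      simp [hB f₁ e₁, h.snd.pair, hg0]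
    rw [h2] at h1
    exact (dvd_sub_right (hdvd g hg hgp)).mp h1
  have hall : ∀ y, p ∣ B y (g v) := fun y => by
    have h1 := hperp (y - B e₁ y • f₁) (by simp [h.snd.pair])
    rw [map_sub, LinearMap.sub_apply, _root_.map_smul, LinearMap.smul_apply, smul_eq_mul] at h1
    exact (dvd_sub_left (Dvd.dvd.mul_left (hdvd g hg hgp) _)).mp h1
  have hp1 : p ∣ 1 := by
    have h1 := hall (g w)
    rwa [hg, hB, hw] at h1
  rcases Int.isUnit_iff.mp (isUnit_of_dvd_one hp1) with rfl | rfl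
  · exact ⟨g, hg, hgp⟩
  · refine ⟨LinearEquiv.neg ℤ * g, mul_mem (fun x y => by simp) hg, ?_⟩
    simp [LinearEquiv.mul_apply, hgp]

/-- In an even lattice containing two orthogonal hyperbolic planes, every hyperbolic pair can be
moved to a given one by an isometry. -/
theorem IsHyperbolicQuadruple.exists_map_pair_eq (hB : ∀ x y, B x y = B y x)
    (heven : ∀ x, Even (B x x)) {e f e₁ f₁ v w : M}
    (h : IsHyperbolicQuadruple B e f e₁ f₁) (hvw : IsHyperbolicPair B v w) :
    ∃ g ∈ isometryGroup B, g v = e ∧ g w = f := by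
  obtain ⟨g₁, hg₁, h1⟩ := h.exists_map_pairing_eq_one hB heven hvw.pair
  obtain ⟨g₂, hg₂, h2, -⟩ := h.fst.exists_map_left_eq hB heven
    ⟨(hvw.map hg₁).left, h.fst.right, (hB _ _).trans h1⟩
  have h3 := (hvw.map hg₁).map hg₂
  rw [h2] at h3
  obtain ⟨g₃, hg₃, h4, h5⟩ := (h.fst.symm hB).exists_map_left_eq hB heven (h3.symm hB)
  refine ⟨g₃ * (g₂ * g₁), mul_mem hg₃ (mul_mem hg₂ hg₁), ?_, ?_⟩
  · simp [LinearEquiv.mul_apply, h2, h5]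
  · simp [LinearEquiv.mul_apply, h4]

end

theorem gramBilin_comm {n : ℕ} {G : Matrix (Fin n) (Fin n) ℤ} (hG : Gᵀ = G)
    (x y : Fin n → ℤ) : gramBilin G x y = gramBilin G y x := by
  simp only [gramBilin, Matrix.toLinearMap₂'_apply']
  rw [dotProduct_comm, ← Matrix.vecMul_transpose, hG, Matrix.dotProduct_mulVec]

theorem even_gramBilin_self {n : ℕ} {G : Matrix (Fin n) (Fin n) ℤ} (hG : Gᵀ = G)
    (hdiag : ∀ i, Even (G i i)) (x : Fin n → ℤ) : Even (gramBilin G x x) := by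
  rw [← Finset.univ_sum_single x]
  refine Finset.sum_induction _ (fun y => Even (gramBilin G y y)) (fun a b ha hb => ?_)
    (by simp) (fun i _ => ?_)
  · have h : gramBilin G (a + b) (a + b) =
        gramBilin G a a + gramBilin G b b + 2 * gramBilin G a b := by
      simp only [map_add, LinearMap.add_apply, gramBilin_comm hG b a]
      ring
    rw [h]
    exact (ha.add hb).add (even_two_mul _)
  · have h : gramBilin G (Pi.single i (x i)) (Pi.single i (x i)) = x i * x i * G i i := by
      simp [gramBilin, Matrix.toLinearMap₂'_apply']
      ring
    rw [h]
    exact (hdiag i).mul_left _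

theorem prodBilin_apply {M N : Type*} [AddCommGroup M] [AddCommGroup N]
    (BM : M →ₗ[ℤ] M →ₗ[ℤ] ℤ) (BN : N →ₗ[ℤ] N →ₗ[ℤ] ℤ) (x y : M × N) :
    prodBilin BM BN x y = BM x.1 y.1 + BN x.2 y.2 := rfl

theorem UGram_transpose : UGramᵀ = UGram := by decide

theorem E8Gram_transpose : E8Gramᵀ = E8Gram := by decide

theorem rankOneGram_transpose (k : ℤ) : (rankOneGram k)ᵀ = rankOneGram k := by
  ext i j
  fin_cases i; fin_cases j; rfl

theorem LambdaB_comm (x y : LambdaM) : LambdaB x y = LambdaB y x := by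
  simp only [LambdaB, prodBilin_apply, gramBilin_comm UGram_transpose x.1,
    gramBilin_comm UGram_transpose x.2.1, gramBilin_comm UGram_transpose x.2.2.1,
    gramBilin_comm E8Gram_transpose x.2.2.2.1, gramBilin_comm E8Gram_transpose x.2.2.2.2.1,
    gramBilin_comm (rankOneGram_transpose _) x.2.2.2.2.2]

theorem even_LambdaB_self (x : LambdaM) : Even (LambdaB x x) := by
  have hU := even_gramBilin_self UGram_transpose (by decide)
  have hE := even_gramBilin_self E8Gram_transpose (by decide)
  have hR := even_gramBilin_self (rankOneGram_transpose (-2)) (by decide)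
  simp only [LambdaB, prodBilin_apply]
  exact (hU _).add ((hU _).add ((hU _).add ((hE _).add ((hE _).add (hR _)))))

theorem gramBilin_UGram (x y : Fin 2 → ℤ) : gramBilin UGram x y = x 0 * y 1 + x 1 * y 0 := by
  simp [gramBilin, UGram, Matrix.toLinearMap₂'_apply', Matrix.mulVec, dotProduct,
    Fin.sum_univ_two]

theorem isHyperbolicQuadruple_LambdaB :
    IsHyperbolicQuadruple LambdaB (![1, 0], 0) (![0, 1], 0) (0, ![1, 0], 0) (0, ![0, 1], 0) := by
  refine ⟨⟨?_, ?_, ?_⟩, ⟨?_, ?_, ?_⟩, ?_, ?_, ?_, ?_⟩ <;>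
    simp [LambdaB, prodBilin_apply, gramBilin_UGram]

/-- An involution with invariant lattice `U` is determined by a hyperbolic basis of that
lattice. -/
theorem exists_hyperbolicPair_involution_eq {ι : LambdaM ≃ₗ[ℤ] LambdaM} (hisom : IsIsometry ι)
    (hinvol : ∀ x, ι (ι x) = x) (hU : IsometricTo (invLattice ι) (gramBilin UGram)) :
    ∃ v w, IsHyperbolicPair LambdaB v w ∧
      ∀ x, ι x = (2 * LambdaB x w) • v + (2 * LambdaB x v) • w - x := by
  obtain ⟨φ, hφ⟩ := hU
  have hmem : ∀ y : invLattice ι, ι y = y := fun y => y.2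
  set v := φ.symm ![1, 0] with hv
  set w := φ.symm ![0, 1] with hw
  have hφv : φ v = ![1, 0] := φ.apply_symm_apply _
  have hφw : φ w = ![0, 1] := φ.apply_symm_apply _
  have hdecomp : ∀ y : invLattice ι,
      (y : LambdaM) = LambdaB y w • (v : LambdaM) + LambdaB y v • (w : LambdaM) := fun y => by
    have h : y = LambdaB y w • v + LambdaB y v • w := by
      apply φ.injective
      rw [← hφ, ← hφ, map_add, _root_.map_smul, _root_.map_smul, hφv, hφw]
      ext i
      fin_cases i <;> simp [gramBilin_UGram]
    exact congrArg Subtype.val h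
  refine ⟨v, w, ⟨?_, ?_, ?_⟩, fun x => ?_⟩
  · rw [← hφ, hφv, gramBilin_UGram]; simp
  · rw [← hφ, hφw, gramBilin_UGram]; simp
  · rw [← hφ, hφv, hφw, gramBilin_UGram]; simp
  · have hx : x + ι x ∈ invLattice ι := by
      change ι (x + ι x) = x + ι x
      rw [map_add, hinvol, add_comm]
    have hfix : ∀ y : invLattice ι, LambdaB (x + ι x) y = 2 * LambdaB x y := fun y => by
      have h := hisom x y
      rw [hmem] at h
      rw [map_add, LinearMap.add_apply, h]
      ring
    have h := hdecomp ⟨x + ι x, hx⟩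
    rw [hfix, hfix] at h
    rw [← h]
    exact (add_sub_cancel_left x (ι x)).symm

end BilinIsometry

/-- Two involutions of `Λ = U³ ⊕ E8² ⊕ ⟨−2⟩` whose invariant sublattices are both
isometric to `U` are conjugate in `O(Λ)`. -/
theorem conjugacy_case_U
    (ι ι' : LambdaM ≃ₗ[ℤ] LambdaM)
    (hisom : IsIsometry ι) (hinvol : ∀ x, ι (ι x) = x)
    (hisom' : IsIsometry ι') (hinvol' : ∀ x, ι' (ι' x) = x)
    (hU : IsometricTo (invLattice ι) (gramBilin UGram))
    (hU' : IsometricTo (invLattice ι') (gramBilin UGram)) :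
    ConjInO ι ι' := by
  obtain ⟨v, w, hvw, hι⟩ :=
    BilinIsometry.exists_hyperbolicPair_involution_eq hisom hinvol hU
  obtain ⟨v', w', hvw', hι'⟩ :=
    BilinIsometry.exists_hyperbolicPair_involution_eq hisom' hinvol' hU'
  obtain ⟨g, hg, hgv, hgw⟩ := BilinIsometry.isHyperbolicQuadruple_LambdaB.exists_map_pair_eq
    BilinIsometry.LambdaB_comm BilinIsometry.even_LambdaB_self hvw
  obtain ⟨g', hg', hgv', hgw'⟩ := BilinIsometry.isHyperbolicQuadruple_LambdaB.exists_map_pair_eq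
    BilinIsometry.LambdaB_comm BilinIsometry.even_LambdaB_self hvw'
  have hγ := mul_mem (inv_mem hg') hg
  have hγv : (g'⁻¹ * g) v = v' := by
    rw [LinearEquiv.mul_apply, hgv, ← hgv']
    exact g'.symm_apply_apply v'
  have hγw : (g'⁻¹ * g) w = w' := by
    rw [LinearEquiv.mul_apply, hgw, ← hgw']
    exact g'.symm_apply_apply w'
  generalize g'⁻¹ * g = γ at hγ hγv hγw
  refine ⟨γ, hγ, fun x => ?_⟩
  obtain ⟨y, rfl⟩ := γ.surjective x
  rw [γ.symm_apply_apply, hι, hι', ← hγv, ← hγw, hγ, hγ, map_sub, map_add,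
    _root_.map_smul, _root_.map_smul]
end
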